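/- arXiv:1209.0320 — 5 statements merged into one kernel-verified Lean document; each statement's English description precedes it below -/
import Mathlib

section
/- Let S1, S2 be metric systems with the same output set Y and metric d, let θ ≥ 0, and let R be an AθA simulation relation from S2 to S1. Then the θ-approximate feedback composition satisfies S1 ×θ^R S2 ≼_θ S2, i.e. the feedback composition is θ-approximately simulated by S2. -/
/-- A system `S = (X, X0, U, →, Y, H)`: a set of states `X` (within a state
universe `α`), a set of initial states `X0 ⊆ X`, a set of inputs `U` (within an
input universe `ν`), a transition relation `→ ⊆ X × U × X`, a set of outputs `Y`
and an output function `H : X → Y`. -/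
structure System (α ν Y : Type*) where
  X : Set α
  X0 : Set α
  U : Set ν
  tr : α → ν → α → Prop
  H : α → Y
  init_sub : X0 ⊆ X
  tr_wf : ∀ ⦃x u x'⦄, tr x u x' → x ∈ X ∧ u ∈ U ∧ x' ∈ X

/-- `R ⊆ X1 × X2` is an ε-approximate simulation relation from `S1` to `S2`
(metric systems with the same output set `Y` and metric `dist`). -/
def IsApproxSim {α₁ ν₁ α₂ ν₂ Y : Type*} [MetricSpace Y] (ε : ℝ)
    (S1 : System α₁ ν₁ Y) (S2 : System α₂ ν₂ Y) (R : Set (α₁ × α₂)) : Prop :=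
  (∀ p ∈ R, p.1 ∈ S1.X ∧ p.2 ∈ S2.X) ∧
  (∀ x1 ∈ S1.X0, ∃ x2 ∈ S2.X0, (x1, x2) ∈ R) ∧
  (∀ p ∈ R, dist (S1.H p.1) (S2.H p.2) ≤ ε) ∧
  (∀ p ∈ R, ∀ u1 x1', S1.tr p.1 u1 x1' →
      ∃ u2 x2', S2.tr p.2 u2 x2' ∧ (x1', x2') ∈ R)

/-- `R ⊆ X1 × X2` is an alternating ε-approximate (AεA) simulation relation
from `S1` to `S2`. -/
def IsAltApproxSim {α₁ ν₁ α₂ ν₂ Y : Type*} [MetricSpace Y] (ε : ℝ)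
    (S1 : System α₁ ν₁ Y) (S2 : System α₂ ν₂ Y) (R : Set (α₁ × α₂)) : Prop :=
  (∀ p ∈ R, p.1 ∈ S1.X ∧ p.2 ∈ S2.X) ∧
  (∀ x1 ∈ S1.X0, ∃ x2 ∈ S2.X0, (x1, x2) ∈ R) ∧
  (∀ p ∈ R, dist (S1.H p.1) (S2.H p.2) ≤ ε) ∧
  (∀ p ∈ R, ∀ u1 ∈ S1.U, ∃ u2 ∈ S2.U,
      ∀ x2', S2.tr p.2 u2 x2' → ∃ x1', S1.tr p.1 u1 x1' ∧ (x1', x2') ∈ R)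

/-- `S1 ≼_ε S2`: `S2` ε-approximately simulates `S1`. -/
def ApproxSimulates {α₁ ν₁ α₂ ν₂ Y : Type*} [MetricSpace Y] (ε : ℝ)
    (S1 : System α₁ ν₁ Y) (S2 : System α₂ ν₂ Y) : Prop :=
  ∃ R, IsApproxSim ε S1 S2 R

/-- `S1 ≼alt_ε S2`: `S2` alternating ε-approximately simulates `S1`. -/
def AltApproxSimulates {α₁ ν₁ α₂ ν₂ Y : Type*} [MetricSpace Y] (ε : ℝ)
    (S1 : System α₁ ν₁ Y) (S2 : System α₂ ν₂ Y) : Prop :=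
  ∃ R, IsAltApproxSim ε S1 S2 R

/-- Given an `AθA` simulation relation `R` from `S2` to `S1`, the θ-approximate
feedback composition `S1 ×θ^R S2`: states `R⁻¹ = {(x1,x2) : (x2,x1) ∈ R}`,
initial states `R⁻¹ ∩ (X0,1 × X0,2)`, inputs `U1`, transitions
`(x1,x2) →u1 (x1',x2')` (between states of `R⁻¹`) whenever `x1 →u1 x1'` in `S1`
and `x2 →u2 x2'` in `S2` for some `u2`, outputs `Y1` and `H(x1,x2) = H1(x1)`. -/
def FeedbackComp {α₁ ν₁ α₂ ν₂ Y : Type*}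
    (S1 : System α₁ ν₁ Y) (S2 : System α₂ ν₂ Y) (R : Set (α₂ × α₁)) :
    System (α₁ × α₂) ν₁ Y where
  X := {p | (p.2, p.1) ∈ R}
  X0 := {p | (p.2, p.1) ∈ R ∧ p.1 ∈ S1.X0 ∧ p.2 ∈ S2.X0}
  U := S1.U
  tr := fun p u p' => (p.2, p.1) ∈ R ∧ (p'.2, p'.1) ∈ R ∧
    S1.tr p.1 u p'.1 ∧ ∃ u2, S2.tr p.2 u2 p'.2
  H := fun p => S1.H p.1
  init_sub := fun _ hp => hp.1
  tr_wf := fun _ _ _ h => ⟨h.1, (S1.tr_wf h.2.2.1).2.1, h.2.1⟩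

/-- if `R` is an `AθA` simulation relation from `S2` to `S1`
(`θ ≥ 0`), then `S1 ×θ^R S2 ≼_θ S2`. -/
theorem feedback_comp_sim_controller {α₁ ν₁ α₂ ν₂ Y : Type*} [MetricSpace Y]
    (S1 : System α₁ ν₁ Y) (S2 : System α₂ ν₂ Y) (θ : ℝ) (hθ : 0 ≤ θ)
    (R : Set (α₂ × α₁)) (hR : IsAltApproxSim θ S2 S1 R) :
    ApproxSimulates θ (FeedbackComp S1 S2 R) S2 := by
  refine ⟨{q | (q.1.2, q.1.1) ∈ R ∧ q.2 = q.1.2}, ?_, ?_, ?_, ?_⟩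
  · rintro ⟨⟨x1, x2⟩, y⟩ ⟨h, e : y = x2⟩
    subst e
    exact ⟨h, (hR.1 _ h).1⟩
  · rintro ⟨x1, x2⟩ ⟨h, -, h2⟩
    exact ⟨x2, h2, h, rfl⟩
  · rintro ⟨⟨x1, x2⟩, y⟩ ⟨h, e : y = x2⟩
    subst e
    exact (dist_comm _ _).trans_le (hR.2.2.1 _ h)
  · rintro ⟨⟨x1, x2⟩, y⟩ ⟨-, e : y = x2⟩ u1 ⟨z1, z2⟩ ⟨-, h, -, u2, h2⟩
    subst e
    exact ⟨u2, z2, h2, h, rfl⟩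
end

section
/- Let S1, S2, S3 be metric systems with the same output set Y and metric d, let θ, γ ≥ 0, let R be an AθA simulation relation from S2 to S1, and suppose S2 ≼_γ S3. Then the θ-approximate feedback composition satisfies S1 ×θ^R S2 ≼_{θ+γ} S3. -/
/-- if `R` is an `AθA` simulation relation from `S2` to `S1`
(`θ, γ ≥ 0`) and `S2 ≼_γ S3`, then `S1 ×θ^R S2 ≼_{θ+γ} S3`. -/
theorem feedback_comp_sim_spec {α₁ ν₁ α₂ ν₂ α₃ ν₃ Y : Type*} [MetricSpace Y]
    (S1 : System α₁ ν₁ Y) (S2 : System α₂ ν₂ Y) (S3 : System α₃ ν₃ Y)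
    (θ γ : ℝ) (hθ : 0 ≤ θ) (hγ : 0 ≤ γ)
    (R : Set (α₂ × α₁)) (hR : IsAltApproxSim θ S2 S1 R)
    (h23 : ApproxSimulates γ S2 S3) :
    ApproxSimulates (θ + γ) (FeedbackComp S1 S2 R) S3 := by
  obtain ⟨Q, hQX, hQ0, hQd, hQt⟩ := h23
  refine ⟨{q | (q.1.2, q.1.1) ∈ R ∧ (q.1.2, q.2) ∈ Q}, ?_, ?_, ?_, ?_⟩
  · rintro ⟨⟨x1, x2⟩, x3⟩ ⟨h12, h23⟩
    exact ⟨h12, (hQX _ h23).2⟩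
  · rintro ⟨x1, x2⟩ ⟨h12, -, h2⟩
    obtain ⟨x3, h3, h23⟩ := hQ0 x2 h2
    exact ⟨x3, h3, h12, h23⟩
  · rintro ⟨⟨x1, x2⟩, x3⟩ ⟨h12, h23⟩
    have hθ' : dist (S1.H x1) (S2.H x2) ≤ θ := dist_comm (S1.H x1) _ ▸ hR.2.2.1 _ h12
    exact (dist_triangle _ (S2.H x2) _).trans (add_le_add hθ' (hQd _ h23))
  · rintro ⟨⟨x1, x2⟩, x3⟩ ⟨-, h23⟩ u1 ⟨x1', x2'⟩ ⟨-, h12', -, u2, ht2⟩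
    obtain ⟨u3, x3', ht3, h23'⟩ := hQt _ h23 u2 x2' ht2
    exact ⟨u3, x3', ht3, h12', h23'⟩
end

section
/- Let S1, S2 be metric systems with the same output set Y and metric d, let θ ≥ 0, and let R be an AθA simulation relation from S2 to S1. Suppose that S2 is non-blocking and that in S1 every state x1 and every input u1 ∈ U1 admits at least one u1-successor. Then the θ-approximate feedback composition S1 ×θ^R S2 is non-blocking. -/
/-- A system is non-blocking if every state has at least one outgoing
transition. -/
def NonBlocking {α ν Y : Type*} (S : System α ν Y) : Prop :=
  ∀ x ∈ S.X, ∃ u x', S.tr x u x'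

/-- if `R` is an `AθA` simulation relation from `S2` to `S1`
(`θ ≥ 0`), `S2` is non-blocking and in `S1` every state and every input
`u1 ∈ U1` admit at least one `u1`-successor, then the feedback composition
`S1 ×θ^R S2` is non-blocking. -/
theorem feedback_comp_nonblocking {α₁ ν₁ α₂ ν₂ Y : Type*} [MetricSpace Y]
    (S1 : System α₁ ν₁ Y) (S2 : System α₂ ν₂ Y) (θ : ℝ) (hθ : 0 ≤ θ)
    (R : Set (α₂ × α₁)) (hR : IsAltApproxSim θ S2 S1 R)
    (h2 : NonBlocking S2)
    (h1 : ∀ x1 ∈ S1.X, ∀ u1 ∈ S1.U, ∃ x1', S1.tr x1 u1 x1') :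
    NonBlocking (FeedbackComp S1 S2 R) := by
  rintro ⟨x1, x2⟩ hx
  obtain ⟨hRX, -, -, hsim⟩ := hR
  obtain ⟨hx2, hx1⟩ := hRX _ hx
  obtain ⟨u2, x2', ht2⟩ := h2 _ hx2
  obtain ⟨u1, hu1, hstep⟩ := hsim _ hx u2 (S2.tr_wf ht2).2.1
  obtain ⟨x1', ht1⟩ := h1 _ hx1 u1 hu1
  obtain ⟨y2, hy2, hy⟩ := hstep x1' ht1
  exact ⟨u1, (x1', y2), hx, hy, ht1, u2, hy2⟩
end

section
/- Let f : ℝⁿ × ℝᵐ → ℝⁿ, let u ∈ ℝᵐ be fixed, and let x1, x2 : [0,τ] → ℝⁿ be differentiable curves satisfying xi'(t) = f(xi(t), u) for all t ∈ [0,τ] (i = 1,2). Let V : ℝⁿ × ℝⁿ → ℝ be continuously differentiable, λ ∈ ℝ, and let α̲, ᾱ be class K∞ functions such that for all z1, z2 ∈ ℝⁿ: (i) α̲(‖z1−z2‖) ≤ V(z1,z2) ≤ ᾱ(‖z1−z2‖), and (ii) ∂V/∂z1(z1,z2)·f(z1,u) + ∂V/∂z2(z1,z2)·f(z2,u) ≤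 λ V(z1,z2). Then for all t ∈ [0,τ], ‖x1(t) − x2(t)‖ ≤ α̲⁻¹( e^{λt} · ᾱ(‖x1(0) − x2(0)‖) ); in particular the distance between the two trajectories is bounded by a continuous function β(r,t) = α̲⁻¹(e^{λt}ᾱ(r)) of the initial mismatch r, which for each fixed t is a class K∞ function of r, i.e. the system is incrementally forward complete (δ-FC). -/
/-- A function `[0,∞) → [0,∞)` of class `K∞`: continuous, strictly increasing,
zero at zero, nonnegative and unbounded. -/
def ClassKInf (g : ℝ → ℝ) : Prop :=
  ContinuousOn g (Set.Ici 0) ∧ StrictMonoOn g (Set.Ici 0) ∧ g 0 = 0 ∧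
  (∀ r ∈ Set.Ici (0 : ℝ), 0 ≤ g r) ∧ ∀ M : ℝ, ∃ r ∈ Set.Ici (0 : ℝ), M ≤ g r

namespace ClassKInf

theorem surjOn {g : ℝ → ℝ} (hg : ClassKInf g) : Set.SurjOn g (Set.Ici 0) (Set.Ici 0) := by
  obtain ⟨hcont, -, h0, -, hunb⟩ := hg
  intro y hy
  obtain ⟨r, hr, hyr⟩ := hunb y
  obtain ⟨s, hs, rfl⟩ := intermediate_value_Icc (Set.mem_Ici.1 hr)
    (hcont.mono Set.Icc_subset_Ici_self) ⟨h0.trans_le hy, hyr⟩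
  exact ⟨s, hs.1, rfl⟩

/-- A left inverse on `[0,∞)` of a class `K∞` function is again of class `K∞`. -/
theorem of_leftInvOn {g h : ℝ → ℝ} (hg : ClassKInf g)
    (hinv : Set.LeftInvOn h g (Set.Ici 0)) : ClassKInf h := by
  have hsurj := hg.surjOn
  obtain ⟨-, hmono, h0, hnonneg, -⟩ := hg
  have h_nonneg : ∀ r ∈ Set.Ici (0 : ℝ), 0 ≤ h r := by
    intro r hr
    obtain ⟨s, hs, rfl⟩ := hsurj hr
    rwa [hinv hs]
  have h_mono : StrictMonoOn h (Set.Ici 0) := by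
    intro a ha b hb hab
    obtain ⟨s, hs, rfl⟩ := hsurj ha
    obtain ⟨t, ht, rfl⟩ := hsurj hb
    rw [hinv hs, hinv ht]
    exact (hmono.lt_iff_lt hs ht).1 hab
  have h_maps : Set.MapsTo h (Set.Ici 0) (Set.Ici 0) := h_nonneg
  have h_strict : StrictMono h_maps.restrict := fun a b hab => h_mono a.2 b.2 hab
  have h_surj : Function.Surjective h_maps.restrict := fun s =>
    ⟨⟨g s, hnonneg s s.2⟩, Subtype.ext (hinv s.2)⟩
  refine ⟨?_, h_mono, ?_, h_nonneg, ?_⟩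
  · rw [continuousOn_iff_continuous_domRestrict]
    exact continuous_subtype_val.comp (h_strict.orderIsoOfSurjective _ h_surj).continuous
  · simpa [h0] using hinv (Set.mem_Ici.2 le_rfl)
  · intro M
    refine ⟨g (max M 0), hnonneg _ (Set.mem_Ici.2 (le_max_right M 0)), ?_⟩
    rw [hinv (Set.mem_Ici.2 (le_max_right M 0))]
    exact le_max_left _ _

theorem comp {g h : ℝ → ℝ} (hg : ClassKInf g) (hh : ClassKInf h) :
    ClassKInf (fun r => g (h r)) := by
  refine ⟨hg.1.comp hh.1 hh.2.2.2.1, hg.2.1.comp hh.2.1 hh.2.2.2.1, ?_, ?_, ?_⟩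
  · simp only [hh.2.2.1, hg.2.2.1]
  · exact fun r hr => hg.2.2.2.1 _ (hh.2.2.2.1 r hr)
  · intro M
    obtain ⟨s, hs, hMs⟩ := hg.2.2.2.2 M
    obtain ⟨r, hr, rfl⟩ := hh.surjOn hs
    exact ⟨r, hr, hMs⟩

theorem const_mul {g : ℝ → ℝ} (hg : ClassKInf g) {c : ℝ} (hc : 0 < c) :
    ClassKInf (fun r => c * g r) := by
  obtain ⟨hcont, hmono, h0, hnonneg, hunb⟩ := hg
  refine ⟨continuousOn_const.mul hcont, ?_, by simp [h0],
    fun r hr => mul_nonneg hc.le (hnonneg r hr), ?_⟩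
  · exact fun a ha b hb hab => mul_lt_mul_of_pos_left (hmono ha hb hab) hc
  · intro M
    obtain ⟨r, hr, hMr⟩ := hunb (M / c)
    exact ⟨r, hr, (div_le_iff₀' hc).1 hMr⟩

end ClassKInf

/-- Grönwall's comparison estimate for a scalar differential inequality `v' ≤ c v`. -/
theorem le_exp_mul_of_hasDerivAt_le_mul {v v' : ℝ → ℝ} {c τ : ℝ}
    (hv : ∀ t ∈ Set.Icc (0 : ℝ) τ, HasDerivAt v (v' t) t)
    (hle : ∀ t ∈ Set.Icc (0 : ℝ) τ, v' t ≤ c * v t) {t : ℝ} (ht : t ∈ Set.Icc (0 : ℝ) τ) :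
    v t ≤ Real.exp (c * t) * v 0 := by
  have hderiv : ∀ s ∈ Set.Icc (0 : ℝ) τ, HasDerivAt (fun s => Real.exp (-(c * s)) * v s)
      (Real.exp (-(c * s)) * (v' s - c * v s)) s := by
    intro s hs
    have h := (((hasDerivAt_id s).const_mul c).neg.exp).mul (hv s hs)
    refine h.congr_deriv ?_
    simp only [id, Pi.neg_apply]
    ring
  have hanti : AntitoneOn (fun s => Real.exp (-(c * s)) * v s) (Set.Icc 0 τ) := by
    refine antitoneOn_of_hasDerivWithinAt_nonpos (convex_Icc 0 τ)
      (fun s hs => (hderiv s hs).continuousAt.continuousWithinAt)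
      (fun s hs => (hderiv s (interior_subset hs)).hasDerivWithinAt) fun s hs => ?_
    exact mul_nonpos_of_nonneg_of_nonpos (Real.exp_pos _).le
      (sub_nonpos.2 (hle s (interior_subset hs)))
  have h := hanti ⟨le_rfl, ht.1.trans ht.2⟩ ht ht.1
  simp only [mul_zero, neg_zero, Real.exp_zero, one_mul] at h
  calc v t = Real.exp (c * t) * (Real.exp (-(c * t)) * v t) := by
        rw [← mul_assoc, ← Real.exp_add, add_neg_cancel, Real.exp_zero, one_mul]
    _ ≤ Real.exp (c * t) * v 0 := mul_le_mul_of_nonneg_left h (Real.exp_pos _).le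

/-- if `x1, x2` are trajectories of `ẋ = f(x,u)` (same constant
input `u`) on `[0,τ]`, and `V` is continuously differentiable with class `K∞`
bounds `α̲(‖z1-z2‖) ≤ V(z1,z2) ≤ ᾱ(‖z1-z2‖)` (infinity norm) and satisfies the
Lyapunov differential inequality with rate `λ`, then for all `t ∈ [0,τ]`,
`‖x1(t)-x2(t)‖ ≤ α̲⁻¹(e^{λ t} ᾱ(‖x1(0)-x2(0)‖))`; in particular
`β(r,t) = α̲⁻¹(e^{λ t} ᾱ(r))` is continuous and, for each fixed `t ≥ 0`, a
class `K∞` function of `r` (incremental forward completeness, δ-FC). -/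
theorem delta_FC_of_lyapunov {n m : ℕ}
    (f : (Fin n → ℝ) → (Fin m → ℝ) → (Fin n → ℝ)) (u : Fin m → ℝ)
    (τ : ℝ) (hτ : 0 ≤ τ) (x1 x2 : ℝ → (Fin n → ℝ))
    (hx1 : ∀ t ∈ Set.Icc (0 : ℝ) τ, HasDerivAt x1 (f (x1 t) u) t)
    (hx2 : ∀ t ∈ Set.Icc (0 : ℝ) τ, HasDerivAt x2 (f (x2 t) u) t)
    (V : (Fin n → ℝ) × (Fin n → ℝ) → ℝ) (hV : ContDiff ℝ 1 V) (lam : ℝ)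
    (alphaL alphaU alphaLinv : ℝ → ℝ)
    (hL : ClassKInf alphaL) (hU : ClassKInf alphaU)
    (hinv1 : ∀ r ∈ Set.Ici (0 : ℝ), alphaLinv (alphaL r) = r)
    (hinv2 : ∀ r ∈ Set.Ici (0 : ℝ), alphaL (alphaLinv r) = r)
    (hbounds : ∀ z1 z2 : Fin n → ℝ,
      alphaL ‖z1 - z2‖ ≤ V (z1, z2) ∧ V (z1, z2) ≤ alphaU ‖z1 - z2‖)
    (hineq : ∀ z1 z2 : Fin n → ℝ,
      fderiv ℝ V (z1, z2) (f z1 u, f z2 u) ≤ lam * V (z1, z2)) :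
    (∀ t ∈ Set.Icc (0 : ℝ) τ,
      ‖x1 t - x2 t‖ ≤ alphaLinv (Real.exp (lam * t) * alphaU ‖x1 0 - x2 0‖)) ∧
    ContinuousOn (fun p : ℝ × ℝ => alphaLinv (Real.exp (lam * p.2) * alphaU p.1))
      (Set.Ici 0 ×ˢ Set.Ici 0) ∧
    ∀ t ∈ Set.Ici (0 : ℝ),
      ClassKInf (fun r => alphaLinv (Real.exp (lam * t) * alphaU r)) := by
  have hLinv : ClassKInf alphaLinv := hL.of_leftInvOn hinv1
  refine ⟨fun t ht => ?_, ?_, fun t _ => hLinv.comp (hU.const_mul (Real.exp_pos _))⟩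
  · have hderiv : ∀ s ∈ Set.Icc (0 : ℝ) τ, HasDerivAt (fun s => V (x1 s, x2 s))
        (fderiv ℝ V (x1 s, x2 s) (f (x1 s) u, f (x2 s) u)) s := fun s hs =>
      (hV.differentiable one_ne_zero (x1 s, x2 s)).hasFDerivAt.comp_hasDerivAt s
        ((hx1 s hs).prodMk (hx2 s hs))
    have hdecay := le_exp_mul_of_hasDerivAt_le_mul hderiv (fun s _ => hineq _ _) ht
    have hle : alphaL ‖x1 t - x2 t‖ ≤ Real.exp (lam * t) * alphaU ‖x1 0 - x2 0‖ :=
      (hbounds _ _).1.trans (hdecay.trans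
        (mul_le_mul_of_nonneg_left (hbounds _ _).2 (Real.exp_pos _).le))
    have hnonneg : 0 ≤ alphaL ‖x1 t - x2 t‖ := hL.2.2.2.1 _ (norm_nonneg _)
    rw [← hinv1 _ (Set.mem_Ici.2 (norm_nonneg (x1 t - x2 t)))]
    exact hLinv.2.1.monotoneOn hnonneg (hnonneg.trans hle) hle
  · refine hLinv.1.comp (ContinuousOn.mul (by fun_prop)
      (hU.1.comp continuousOn_fst fun p hp => hp.1)) fun p hp => ?_
    exact mul_nonneg (Real.exp_pos _).le (hU.2.2.2.1 _ hp.1)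
end

section
/- Consider the unicycle vector field f : ℝ³ × ℝ² → ℝ³ given by f(x,u) = (u1·cos(x3), u1·sin(x3), u2), and the function V(x,x') = (1/2)·‖x − x'‖₂², where ‖·‖₂ is the Euclidean norm on ℝ³. Then for all x, x' ∈ ℝ³ and all u = (u1,u2) ∈ ℝ², the inner product ⟨x − x', f(x,u) − f(x',u)⟩ ≤ 2·|u1|·V(x,x'); i.e. V is a δ-FC Lyapunov function for the unicycle with λ = 2|u1|. -/
open RealInnerProductSpace

/-- The unicycle vector field `f(x,u) = (u1 cos x3, u1 sin x3, u2)` on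
`ℝ³` (with the Euclidean structure). -/
noncomputable def unicycleField (x : EuclideanSpace ℝ (Fin 3)) (u : Fin 2 → ℝ) :
    EuclideanSpace ℝ (Fin 3) :=
  (WithLp.equiv 2 (Fin 3 → ℝ)).symm
    ![u 0 * Real.cos (x 2), u 0 * Real.sin (x 2), u 1]

/-- For a fixed input, the unicycle vector field is Lipschitz in the state, with constant the
absolute value of the forward velocity. -/
theorem norm_unicycleField_sub_le (x x' : EuclideanSpace ℝ (Fin 3)) (u : Fin 2 → ℝ) :
    ‖unicycleField x u - unicycleField x' u‖ ≤ |u 0| * ‖x - x'‖ := by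
  have chord : (Real.cos (x 2) - Real.cos (x' 2)) ^ 2 + (Real.sin (x 2) - Real.sin (x' 2)) ^ 2 ≤
      (x 2 - x' 2) ^ 2 := by
    have h := Real.one_sub_sq_div_two_le_cos (x := x 2 - x' 2)
    rw [Real.cos_sub] at h
    linarith [Real.sin_sq_add_cos_sq (x 2), Real.sin_sq_add_cos_sq (x' 2)]
  refine (sq_le_sq₀ (norm_nonneg _) (by positivity)).mp ?_
  rw [mul_pow, sq_abs, EuclideanSpace.real_norm_sq_eq, EuclideanSpace.real_norm_sq_eq]
  simp only [Fin.sum_univ_three, unicycleField, WithLp.equiv_symm_apply, PiLp.sub_apply,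
    Matrix.cons_val]
  nlinarith [mul_le_mul_of_nonneg_left chord (sq_nonneg (u 0)),
    mul_nonneg (sq_nonneg (u 0)) (sq_nonneg (x 0 - x' 0)),
    mul_nonneg (sq_nonneg (u 0)) (sq_nonneg (x 1 - x' 1))]

/-- for the unicycle and `V(x,x') = (1/2)‖x - x'‖₂²` (Euclidean
norm), for all `x, x'` and all inputs `u`,
`⟪x - x', f(x,u) - f(x',u)⟫ ≤ 2 |u1| V(x,x')`; i.e. `V` is a δ-FC Lyapunov
function for the unicycle with `λ = 2|u1|`. -/
theorem unicycle_delta_FC_lyapunov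
    (x x' : EuclideanSpace ℝ (Fin 3)) (u : Fin 2 → ℝ) :
    ⟪x - x', unicycleField x u - unicycleField x' u⟫ ≤
      2 * |u 0| * ((1 / 2) * ‖x - x'‖ ^ 2) := by
  calc ⟪x - x', unicycleField x u - unicycleField x' u⟫
      ≤ ‖x - x'‖ * ‖unicycleField x u - unicycleField x' u‖ := real_inner_le_norm _ _
    _ ≤ ‖x - x'‖ * (|u 0| * ‖x - x'‖) := by
      gcongr
      exact norm_unicycleField_sub_le x x' u
    _ = 2 * |u 0| * ((1 / 2) * ‖x - x'‖ ^ 2) := by ring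
end
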